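/- For every dimension d ≥ 2 there exist constants C > 0 and μ₀ ≥ 1, depending only on d, with the following property. Let λ ≥ 1 and μ ≥ μ₀. Let v₀ be a (complex-valued) Schwartz function on ℝ^d whose Fourier transform is supported in the ball {ξ : |ξ| ≤ 9λ/4}, and let v(t) be its half-wave evolution, i.e. the function whose spatial Fourier transform is e^{−it|ξ|}·v̂₀(ξ), so that i∂_tv − Λv = 0 with v(0) = v₀. Let E₀ be a Schwartz function on ℝ^d whose Fourier transform is supported in A_μ ∩ {ξ = (ξ₁, ξ') ∈ ℝ × ℝ^{d−1} : |ξ₁| ≥ 100|ξ'|}, where A_μ = {ξ : 8μ/9 ≤ |ξ| ≤ 9μ/4}, and let E(t) = e^{itΔ}E₀. Then for every T > 0, ( ∫₀^T ∫_ℝ ( ∫_{ℝ^{d−1}} |v(t,x₁,y) E(t,x₁,y)| dy )² dx₁ dt )^{1/2} ≤ C μ^{−1/2} ‖E₀‖_{L²(ℝ^d)} ‖v₀‖_{L²(ℝ^d)}. -/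

import Mathlib

open MeasureTheory

noncomputable section

/-- The dot product on `ℝ^d = ℝ × ℝ^{d-1}`. -/
def dotp {k : ℕ} (x ξ : ℝ × (Fin k → ℝ)) : ℝ := x.1 * ξ.1 + ∑ i, x.2 i * ξ.2 i

/-- The squared Euclidean norm on `ℝ^d = ℝ × ℝ^{d-1}`. -/
def nsq {k : ℕ} (ξ : ℝ × (Fin k → ℝ)) : ℝ := ξ.1 ^ 2 + ∑ i, ξ.2 i ^ 2

/-- The Fourier transform `û(ξ) = ∫ e^{-i x·ξ} u(x) dx`. -/
def FT {k : ℕ} (u : (ℝ × (Fin k → ℝ)) → ℂ) (ξ : ℝ × (Fin k → ℝ)) : ℂ :=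
  ∫ x : ℝ × (Fin k → ℝ), Complex.exp (-Complex.I * (dotp x ξ : ℂ)) * u x

/-- The free Schrödinger evolution `e^{itΔ}u₀`. -/
def schrodingerEvol {k : ℕ} (u₀ : (ℝ × (Fin k → ℝ)) → ℂ) (t : ℝ)
    (x : ℝ × (Fin k → ℝ)) : ℂ :=
  ((2 * Real.pi) ^ (k + 1) : ℝ)⁻¹ •
    ∫ ξ : ℝ × (Fin k → ℝ),
      Complex.exp (Complex.I * (dotp x ξ : ℂ) - Complex.I * (t : ℂ) * (nsq ξ : ℂ)) * FT u₀ ξ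

/-- The free wave evolution of data `(n₀, n₁)`, i.e. the function whose spatial Fourier
transform is `cos(t|ξ|) n̂₀(ξ) + (sin(t|ξ|)/|ξ|) n̂₁(ξ)`. -/
def waveEvol {k : ℕ} (n₀ n₁ : (ℝ × (Fin k → ℝ)) → ℂ) (t : ℝ) (x : ℝ × (Fin k → ℝ)) : ℂ :=
  ((2 * Real.pi) ^ (k + 1) : ℝ)⁻¹ •
    ∫ ξ : ℝ × (Fin k → ℝ),
      Complex.exp (Complex.I * (dotp x ξ : ℂ)) *
        ((Real.cos (t * Real.sqrt (nsq ξ)) : ℂ) * FT n₀ ξ +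
         ((Real.sin (t * Real.sqrt (nsq ξ)) / Real.sqrt (nsq ξ) : ℝ) : ℂ) * FT n₁ ξ)

/-- The half-wave evolution `e^{-itΛ}v₀`, `Λ = (-Δ)^{1/2}`, i.e. the function whose spatial
Fourier transform is `e^{-it|ξ|} v̂₀(ξ)`. -/
def halfWaveEvol {k : ℕ} (v₀ : (ℝ × (Fin k → ℝ)) → ℂ) (t : ℝ) (x : ℝ × (Fin k → ℝ)) : ℂ :=
  ((2 * Real.pi) ^ (k + 1) : ℝ)⁻¹ •
    ∫ ξ : ℝ × (Fin k → ℝ),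
      Complex.exp (Complex.I * (dotp x ξ : ℂ) -
        Complex.I * (t : ℂ) * (Real.sqrt (nsq ξ) : ℂ)) * FT v₀ ξ

/-- Membership in the annulus `A_λ = {ξ : 8λ/9 ≤ |ξ| ≤ 9λ/4}`. -/
def inA {k : ℕ} (lam : ℝ) (ξ : ℝ × (Fin k → ℝ)) : Prop :=
  8 * lam / 9 ≤ Real.sqrt (nsq ξ) ∧ Real.sqrt (nsq ξ) ≤ 9 * lam / 4

/-- Membership in the cone `{ξ = (ξ₁, ξ') : |ξ₁| ≥ 100|ξ'|}`. -/
def inCone {k : ℕ} (ξ : ℝ × (Fin k → ℝ)) : Prop :=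
  100 * Real.sqrt (∑ i, ξ.2 i ^ 2) ≤ |ξ.1|

/-- The Fourier transform of the Gaussian weight `x ↦ exp (-ε x²)` on the line. -/
def gaussKer (ε q : ℝ) : ℝ := √(Real.pi / ε) * Real.exp (-q ^ 2 / (4 * ε))

lemma gaussKer_nonneg (ε q : ℝ) : 0 ≤ gaussKer ε q := by unfold gaussKer; positivity

lemma gaussKer_neg (ε q : ℝ) : gaussKer ε (-q) = gaussKer ε q := by simp [gaussKer]

lemma gaussKer_sub_comm (ε p q : ℝ) : gaussKer ε (p - q) = gaussKer ε (q - p) := by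
  rw [← gaussKer_neg, neg_sub]

@[fun_prop]
lemma continuous_gaussKer (ε : ℝ) : Continuous (gaussKer ε) := by
  unfold gaussKer; fun_prop

lemma integral_gaussKer_eq {ε : ℝ} (hε : 0 < ε) : ∫ q, gaussKer ε q = 2 * Real.pi := by
  unfold gaussKer
  rw [integral_const_mul]
  have : ∀ q : ℝ, Real.exp (-q ^ 2 / (4 * ε)) = Real.exp (-(1 / (4 * ε)) * q ^ 2) := by
    intro q; congr 1; ring
  simp_rw [this]
  rw [integral_gaussian, ← Real.sqrt_mul (by positivity)]
  have : Real.pi / ε * (Real.pi / (1 / (4 * ε))) = (2 * Real.pi) ^ 2 := by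
    field_simp; ring
  rw [this, Real.sqrt_sq (by positivity)]

lemma integrable_gaussKer {ε : ℝ} (hε : 0 < ε) : Integrable (gaussKer ε) := by
  by_contra h
  have := integral_gaussKer_eq hε
  rw [integral_undef h] at this
  linarith [Real.pi_pos]

lemma lintegral_gaussKer {ε : ℝ} (hε : 0 < ε) :
    ∫⁻ q, ENNReal.ofReal (gaussKer ε q) = ENNReal.ofReal (2 * Real.pi) := by
  rw [← integral_gaussKer_eq hε, ofReal_integral_eq_lintegral_ofReal (integrable_gaussKer hε)]
  exact Filter.Eventually.of_forall fun q => gaussKer_nonneg ε q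

lemma integral_cexp_mul_gaussian {ε : ℝ} (hε : 0 < ε) (q : ℝ) :
    ∫ x : ℝ, Complex.exp (Complex.I * ((x * q : ℝ) : ℂ)) * (Real.exp (-ε * x ^ 2) : ℝ)
      = (gaussKer ε q : ℂ) := by
  have h := fourierIntegral_gaussian (b := (ε : ℂ)) (by simpa using hε) (q : ℂ)
  have h2 : ((Real.pi : ℂ) / (ε : ℂ)) ^ (1 / 2 : ℂ) = ((√(Real.pi / ε) : ℝ) : ℂ) := by
    rw [Real.sqrt_eq_rpow, Complex.ofReal_cpow (by positivity)]
    push_cast; rfl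
  rw [h2] at h
  convert h using 2
  · ext x; push_cast; congr 2; ring
  · simp [gaussKer]

/-- The product kernel on `ℝ^k`. -/
def gaussKerPi {k : ℕ} (ε : ℝ) (y : Fin k → ℝ) : ℝ := ∏ i, gaussKer ε (y i)

lemma gaussKerPi_nonneg {k : ℕ} (ε : ℝ) (y : Fin k → ℝ) : 0 ≤ gaussKerPi ε y :=
  Finset.prod_nonneg fun i _ => gaussKer_nonneg ε (y i)

lemma gaussKerPi_sub_comm {k : ℕ} (ε : ℝ) (y z : Fin k → ℝ) :
    gaussKerPi ε (y - z) = gaussKerPi ε (z - y) :=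
  Finset.prod_congr rfl fun i _ => gaussKer_sub_comm ε (y i) (z i)

@[fun_prop]
lemma continuous_gaussKerPi {k : ℕ} (ε : ℝ) : Continuous (gaussKerPi (k := k) ε) := by
  unfold gaussKerPi; fun_prop

lemma lintegral_gaussKerPi_sub {k : ℕ} {ε : ℝ} (hε : 0 < ε) (a : Fin k → ℝ) :
    ∫⁻ y : Fin k → ℝ, ENNReal.ofReal (gaussKerPi ε (a - y))
      = ENNReal.ofReal ((2 * Real.pi) ^ k) := by
  rw [lintegral_sub_left_eq_self (fun y => ENNReal.ofReal (gaussKerPi ε y))]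
  rw [← ofReal_integral_eq_lintegral_ofReal]
  · unfold gaussKerPi
    rw [integral_fintype_prod_volume_eq_pow (gaussKer ε), integral_gaussKer_eq hε]
    simp
  · exact Integrable.fintype_prod (f := fun _ : Fin k => gaussKer ε)
      fun i => integrable_gaussKer hε
  · exact Filter.Eventually.of_forall fun q => gaussKerPi_nonneg ε q

lemma integral_cexp_mul_gaussian_pi {k : ℕ} {ε : ℝ} (hε : 0 < ε) (q : Fin k → ℝ) :
    ∫ y : Fin k → ℝ, Complex.exp (Complex.I * ((∑ i, y i * q i : ℝ) : ℂ)) *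
        (Real.exp (-ε * ∑ i, y i ^ 2) : ℝ) = (gaussKerPi ε q : ℂ) := by
  have h := integral_fintype_prod_volume_eq_prod (𝕜 := ℂ)
    (fun (i : Fin k) (x : ℝ) =>
      Complex.exp (Complex.I * ((x * q i : ℝ) : ℂ)) * (Real.exp (-ε * x ^ 2) : ℝ))
  simp_rw [integral_cexp_mul_gaussian hε] at h
  rw [gaussKerPi, Complex.ofReal_prod, ← h]
  congr 1; ext y
  rw [Finset.prod_mul_distrib, ← Complex.exp_sum, ← Complex.ofReal_prod, ← Real.exp_sum,
    Complex.ofReal_sum, Finset.mul_sum, Finset.mul_sum]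

lemma integrable_exp_neg_mul_sum_sq {k : ℕ} {ε : ℝ} (hε : 0 < ε) :
    Integrable fun y : Fin k → ℝ => Real.exp (-ε * ∑ i, y i ^ 2) := by
  have h := Integrable.fintype_prod (f := fun (_ : Fin k) (x : ℝ) => Real.exp (-ε * x ^ 2))
      fun i => integrable_exp_neg_mul_sq hε
  refine h.congr (Filter.Eventually.of_forall fun y => ?_)
  simp only [Finset.mul_sum, Real.exp_sum]

lemma abs_sqrt_sq_add_sub_le {M : ℝ} (hM : 0 ≤ M) (a b : ℝ) :
    |√(a ^ 2 + M) - √(b ^ 2 + M)| ≤ |a - b| := by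
  have key : ∀ a b : ℝ, √(a ^ 2 + M) ≤ √(b ^ 2 + M) + |a - b| := by
    intro a b
    have hB : |b| ≤ √(b ^ 2 + M) := by
      rw [← Real.sqrt_sq_eq_abs]; exact Real.sqrt_le_sqrt (by linarith)
    have hB2 : √(b ^ 2 + M) ^ 2 = b ^ 2 + M := Real.sq_sqrt (by positivity)
    rw [Real.sqrt_le_left (by positivity)]
    have h1 : b * (a - b) ≤ √(b ^ 2 + M) * |a - b| :=
      (le_abs_self _).trans (by rw [abs_mul]; gcongr)
    nlinarith [sq_abs (a - b)]
  rw [abs_sub_le_iff]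
  constructor
  · linarith [key a b]
  · have := key b a
    rw [abs_sub_comm] at this
    linarith

lemma ofReal_mul_setLIntegral_comp_le {s : Set ℝ} {f f' : ℝ → ℝ} (hs : MeasurableSet s)
    (hf' : ∀ x ∈ s, HasDerivWithinAt f (f' x) s x) (hf : Set.InjOn f s) {b : ℝ}
    (hb : ∀ x ∈ s, b ≤ |f' x|) (g : ℝ → ENNReal) :
    ENNReal.ofReal b * ∫⁻ x in s, g (f x) ≤ ∫⁻ u, g u := by
  rw [← lintegral_const_mul' _ _ ENNReal.ofReal_ne_top]
  calc ∫⁻ x in s, ENNReal.ofReal b * g (f x)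
      ≤ ∫⁻ x in s, ENNReal.ofReal |f' x| * g (f x) :=
        setLIntegral_mono' hs fun x hx => by gcongr; exact hb x hx
    _ = ∫⁻ u in f '' s, g u := (lintegral_image_eq_lintegral_abs_deriv_mul hs hf' hf g).symm
    _ ≤ ∫⁻ u, g u := setLIntegral_le_lintegral _ _

/-- On a half-line of high frequencies the resonance function `ξ ↦ |(s - ξ, η)| + ξ²` has
derivative at least `2c - 1`, hence pulls back integrals with a gain `(2c - 1)⁻¹`. -/
lemma setLIntegral_resonance_le_of_subset {c : ℝ} (hc : 1 < 2 * c) (s : ℝ) {M : ℝ} (hM : 0 ≤ M)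
    (g : ℝ → ENNReal) {S : Set ℝ} (hS : MeasurableSet S)
    (hS2 : ∀ a ∈ S, ∀ b ∈ S, 2 * c ≤ |a + b|) :
    ENNReal.ofReal (2 * c - 1) * ∫⁻ ξ in S, g (√((s - ξ) ^ 2 + M) + ξ ^ 2) ≤ ∫⁻ u, g u := by
  have hS' : (S \ {s} : Set ℝ) =ᵐ[volume] S := sdiff_null_ae_eq_self (by simp)
  rw [← setLIntegral_congr hS']
  refine ofReal_mul_setLIntegral_comp_le
    (f' := fun ξ => (2 * (s - ξ) * (-1)) / (2 * √((s - ξ) ^ 2 + M)) + 2 * ξ)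
    (f := fun ξ => √((s - ξ) ^ 2 + M) + ξ ^ 2)
    (hS.diff (measurableSet_singleton s)) ?_ ?_ ?_ g
  · rintro x ⟨-, hx⟩
    have hx' : s - x ≠ 0 := sub_ne_zero.2 fun h => hx h.symm
    have hpos : (s - x) ^ 2 + M ≠ 0 := by positivity
    refine HasDerivAt.hasDerivWithinAt (HasDerivAt.add ?_ ?_)
    · refine HasDerivAt.sqrt ?_ hpos
      simpa using (((hasDerivAt_id x).const_sub s).pow 2).add_const M
    · simpa using hasDerivAt_pow 2 x
  · rintro a ⟨ha, -⟩ b ⟨hb, -⟩ hab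
    have h1 := abs_sqrt_sq_add_sub_le hM (s - a) (s - b)
    have h2 := hS2 a ha b hb
    have h3 : √((s - a) ^ 2 + M) - √((s - b) ^ 2 + M) = (b - a) * (a + b) := by
      linarith [hab]
    rw [h3, abs_mul, show s - a - (s - b) = b - a by ring] at h1
    by_contra hne
    have h4 : 0 < |b - a| := abs_pos.2 (sub_ne_zero.2 fun h => hne h.symm)
    nlinarith
  · rintro x ⟨hx, -⟩
    have h2 := hS2 x hx x hx
    have h3 : |2 * (s - x) * (-1) / (2 * √((s - x) ^ 2 + M))| ≤ 1 := by
      rw [abs_div, abs_of_nonneg (a := 2 * √((s - x) ^ 2 + M)) (by positivity)]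
      refine div_le_one_of_le₀ ?_ (by positivity)
      rw [abs_mul, abs_mul, abs_neg, abs_one, abs_two, mul_one, ← Real.sqrt_sq_eq_abs]
      gcongr
      linarith
    rw [← two_mul] at h2
    have h4 := abs_sub_abs_le_abs_sub (2 * x) (-(2 * (s - x) * (-1) / (2 * √((s - x) ^ 2 + M))))
    rw [abs_neg, sub_neg_eq_add, add_comm (2 * x)] at h4
    linarith

lemma setLIntegral_resonance_le {c : ℝ} (hc : 1 < 2 * c) (s : ℝ) {M : ℝ} (hM : 0 ≤ M)
    (g : ℝ → ENNReal) :
    ENNReal.ofReal (2 * c - 1) * ∫⁻ ξ in {ξ | c ≤ |ξ|}, g (√((s - ξ) ^ 2 + M) + ξ ^ 2)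
      ≤ 2 * ∫⁻ u, g u := by
  have hsub : {ξ : ℝ | c ≤ |ξ|} ⊆ Set.Ici c ∪ Set.Iic (-c) := by
    intro ξ (hξ : c ≤ |ξ|)
    rcases le_abs.1 hξ with h | h
    · exact Or.inl h
    · exact Or.inr (le_neg_of_le_neg h)
  calc ENNReal.ofReal (2 * c - 1) * ∫⁻ ξ in {ξ | c ≤ |ξ|}, g (√((s - ξ) ^ 2 + M) + ξ ^ 2)
      ≤ ENNReal.ofReal (2 * c - 1) * ((∫⁻ ξ in Set.Ici c, g (√((s - ξ) ^ 2 + M) + ξ ^ 2))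
        + ∫⁻ ξ in Set.Iic (-c), g (√((s - ξ) ^ 2 + M) + ξ ^ 2)) := by
        gcongr
        exact (lintegral_mono_set hsub).trans (lintegral_union_le _ _ _)
    _ ≤ (∫⁻ u, g u) + ∫⁻ u, g u := by
        rw [mul_add]
        refine add_le_add (setLIntegral_resonance_le_of_subset hc s hM g measurableSet_Ici ?_)
          (setLIntegral_resonance_le_of_subset hc s hM g measurableSet_Iic ?_)
        · intro a (ha : c ≤ a) b (hb : c ≤ b)
          exact le_abs.2 (Or.inl (by linarith))
        · intro a (ha : a ≤ -c) b (hb : b ≤ -c)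
          exact le_abs.2 (Or.inr (by linarith))
    _ = 2 * ∫⁻ u, g u := (two_mul _).symm

/-- Schur's test for a symmetric kernel. -/
lemma lintegral_schur_le {P : Type*} [MeasurableSpace P] {μ : Measure P} [SFinite μ]
    {k : P → P → ENNReal} (hk : Measurable (Function.uncurry k)) (hsymm : ∀ p q, k p q = k q p)
    {M : ENNReal} (hM : ∀ p, ∫⁻ q, k p q ∂μ ≤ M) {h : P → ENNReal} (hh : Measurable h) :
    ∫⁻ z : P × P, h z.1 * h z.2 * k z.1 z.2 ∂(μ.prod μ) ≤ M * ∫⁻ p, h p ^ 2 ∂μ := by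
  have hk' : Measurable fun z : P × P => k z.1 z.2 := hk
  have h1 : ∫⁻ z : P × P, h z.1 ^ 2 * k z.1 z.2 ∂(μ.prod μ) ≤ M * ∫⁻ p, h p ^ 2 ∂μ := by
    rw [lintegral_prod _ (by fun_prop)]
    calc ∫⁻ p, ∫⁻ q, h p ^ 2 * k p q ∂μ ∂μ = ∫⁻ p, h p ^ 2 * ∫⁻ q, k p q ∂μ ∂μ := by
          refine lintegral_congr fun p => lintegral_const_mul _ (hk.of_uncurry_left)
      _ ≤ ∫⁻ p, M * h p ^ 2 ∂μ := by
          refine lintegral_mono fun p => ?_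
          rw [mul_comm]
          gcongr
          exact hM p
      _ = M * ∫⁻ p, h p ^ 2 ∂μ := lintegral_const_mul _ (by fun_prop)
  have h2 : ∫⁻ z : P × P, h z.2 ^ 2 * k z.1 z.2 ∂(μ.prod μ)
      = ∫⁻ z : P × P, h z.1 ^ 2 * k z.1 z.2 ∂(μ.prod μ) := by
    rw [lintegral_prod _ (by fun_prop), lintegral_prod_symm _ (by fun_prop)]
    simp_rw [hsymm]
  have h3 : ∀ a b : ENNReal, 2 * (a * b) ≤ a ^ 2 + b ^ 2 := by
    intro a b
    rcases eq_or_ne a ⊤ with rfl | ha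
    · simp
    rcases eq_or_ne b ⊤ with rfl | hb
    · simp
    lift a to NNReal using ha
    lift b to NNReal using hb
    norm_cast
    rw [← mul_assoc]
    exact two_mul_le_add_sq a b
  have h4 : 2 * ∫⁻ z : P × P, h z.1 * h z.2 * k z.1 z.2 ∂(μ.prod μ)
      ≤ 2 * (M * ∫⁻ p, h p ^ 2 ∂μ) := by
    rw [← lintegral_const_mul _ (by fun_prop)]
    calc ∫⁻ z : P × P, 2 * (h z.1 * h z.2 * k z.1 z.2) ∂(μ.prod μ)
        ≤ ∫⁻ z : P × P, (h z.1 ^ 2 * k z.1 z.2 + h z.2 ^ 2 * k z.1 z.2) ∂(μ.prod μ) := by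
          refine lintegral_mono fun z => ?_
          rw [← add_mul, ← mul_assoc]
          gcongr
          exact h3 _ _
      _ ≤ 2 * (M * ∫⁻ p, h p ^ 2 ∂μ) := by
          rw [lintegral_add_left (by fun_prop), h2, two_mul]
          gcongr
  exact (ENNReal.mul_le_mul_iff_right (by simp) (by simp)).1 h4

lemma norm_cexp_I_mul_ofReal (x : ℝ) : ‖Complex.exp (Complex.I * (x : ℂ))‖ = 1 := by
  rw [mul_comm, Complex.norm_exp_ofReal_mul_I]

/-- The `T T*` bound for a weighted oscillatory integral operator. -/
lemma lintegral_enorm_sq_oscillatory_mul_le {X P : Type*} [MeasurableSpace X] [MeasurableSpace P]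
    {ν : Measure X} {μ : Measure P} [SFinite ν] [SFinite μ] {θ : X → P → ℝ}
    (hθ : Measurable (Function.uncurry θ)) {γ : X → ℝ} (hγ : Integrable γ ν)
    (hγ0 : ∀ x, 0 ≤ γ x) {k : P → P → ENNReal}
    (hk : Measurable (Function.uncurry k)) (hsymm : ∀ p q, k p q = k q p)
    (hK : ∀ p q, ‖∫ x, Complex.exp (Complex.I * ((θ x p - θ x q : ℝ) : ℂ)) * (γ x : ℂ) ∂ν‖ₑ
      ≤ k p q)
    {M : ENNReal} (hM : ∀ p, ∫⁻ q, k p q ∂μ ≤ M) {H : P → ℂ} (hH : StronglyMeasurable H) :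
    ∫⁻ x, ‖∫ p, Complex.exp (Complex.I * (θ x p : ℂ)) * H p ∂μ‖ₑ ^ 2 * ENNReal.ofReal (γ x) ∂ν
      ≤ M * ∫⁻ p, ‖H p‖ₑ ^ 2 ∂μ := by
  have hθ1 : ∀ x, Measurable (θ x) := fun x => hθ.of_uncurry_left
  by_cases hHi : Integrable H μ
  swap
  · have h0 : ∀ x, ∫ p, Complex.exp (Complex.I * (θ x p : ℂ)) * H p ∂μ = 0 := by
      intro x
      refine integral_undef fun h => hHi ?_
      rw [← integrable_norm_iff hH.aestronglyMeasurable]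
      simpa [norm_cexp_I_mul_ofReal] using h.norm
    simp [h0]
  set F : X → ℂ := fun x => ∫ p, Complex.exp (Complex.I * (θ x p : ℂ)) * H p ∂μ with hF
  let Φ : X → P × P → ℂ := fun x z =>
    Complex.exp (Complex.I * ((θ x z.1 - θ x z.2 : ℝ) : ℂ)) *
      ((γ x : ℂ) * (H z.1 * (starRingEnd ℂ) (H z.2)))
  have hHc : Integrable (fun p => (starRingEnd ℂ) (H p)) μ :=
    (integrable_norm_iff (Complex.continuous_conj.comp_aestronglyMeasurable
      hH.aestronglyMeasurable)).1 (by simpa using hHi.norm)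
  have hθ2 : Measurable fun z : X × P => θ z.1 z.2 := hθ
  have hΦ : Integrable (Function.uncurry Φ) (ν.prod (μ.prod μ)) := by
    refine Integrable.bdd_mul (c := 1) (hγ.ofReal.mul_prod (hHi.mul_prod hHc)) ?_ ?_
    · refine Measurable.aestronglyMeasurable ?_
      have e1 : Measurable fun z : X × (P × P) => θ z.1 z.2.1 :=
        hθ2.comp (measurable_fst.prodMk (measurable_fst.comp measurable_snd))
      have e2 : Measurable fun z : X × (P × P) => θ z.1 z.2.2 :=
        hθ2.comp (measurable_fst.prodMk (measurable_snd.comp measurable_snd))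
      fun_prop
    · exact Filter.Eventually.of_forall fun z => (norm_cexp_I_mul_ofReal _).le
  have hFΦ : ∀ x, ∫ z, Φ x z ∂(μ.prod μ) = ((‖F x‖ ^ 2 * γ x : ℝ) : ℂ) := by
    intro x
    have e1 : ((‖F x‖ ^ 2 : ℝ) : ℂ) = F x * (starRingEnd ℂ) (F x) := by
      rw [Complex.mul_conj, Complex.normSq_eq_norm_sq]
    rw [Complex.ofReal_mul, e1, hF]
    simp only
    rw [← integral_conj, ← integral_prod_mul, ← integral_mul_const]
    refine integral_congr_ae (Filter.Eventually.of_forall fun z => ?_)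
    simp only [Φ, map_mul, ← Complex.exp_conj, Complex.conj_I, Complex.conj_ofReal]
    rw [Complex.ofReal_sub, mul_sub, sub_eq_add_neg, Complex.exp_add, neg_mul]
    ring
  have hFi : Integrable (fun x => ‖F x‖ ^ 2 * γ x) ν := by
    have := hΦ.integral_prod_left
    simp only [Function.uncurry_apply_pair, hFΦ] at this
    exact this.re
  calc ∫⁻ x, ‖F x‖ₑ ^ 2 * ENNReal.ofReal (γ x) ∂ν
      = ∫⁻ x, ENNReal.ofReal (‖F x‖ ^ 2 * γ x) ∂ν := by
        refine lintegral_congr fun x => ?_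
        rw [ENNReal.ofReal_mul (by positivity), ENNReal.ofReal_pow (by positivity),
          ofReal_norm]
    _ = ‖∫ z, ∫ x, Φ x z ∂ν ∂(μ.prod μ)‖ₑ := by
        rw [← ofReal_integral_eq_lintegral_ofReal hFi
          (Filter.Eventually.of_forall fun x => mul_nonneg (by positivity) (hγ0 x)),
          ← integral_integral_swap hΦ]
        simp_rw [hFΦ]
        rw [integral_complex_ofReal, ← ofReal_norm, Complex.norm_real,
          Real.norm_of_nonneg (integral_nonneg fun x => mul_nonneg (by positivity) (hγ0 x))]
    _ ≤ ∫⁻ z, ‖∫ x, Φ x z ∂ν‖ₑ ∂(μ.prod μ) := enorm_integral_le_lintegral_enorm _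
    _ ≤ ∫⁻ z : P × P, ‖H z.1‖ₑ * ‖H z.2‖ₑ * k z.1 z.2 ∂(μ.prod μ) := by
        refine lintegral_mono fun z => ?_
        simp only [Φ, ← mul_assoc]
        rw [integral_mul_const, integral_mul_const, enorm_mul, enorm_mul, RCLike.enorm_conj,
          mul_assoc, mul_comm]
        gcongr
        exact hK _ _
    _ ≤ M * ∫⁻ p, ‖H p‖ₑ ^ 2 ∂μ := lintegral_schur_le hk hsymm hM hH.enorm

/-- The `T T*` bound for an oscillatory integral operator, with weights removed in the limit. -/
lemma lintegral_enorm_sq_oscillatory_le {X P : Type*} [MeasurableSpace X] [MeasurableSpace P]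
    {ν : Measure X} {μ : Measure P} [SFinite ν] [SFinite μ] {θ : X → P → ℝ}
    (hθ : Measurable (Function.uncurry θ)) {γ : ℕ → X → ℝ} (hγ : ∀ n, Integrable (γ n) ν)
    (hγm : ∀ n, Measurable (γ n)) (hγ0 : ∀ n x, 0 ≤ γ n x)
    (hγ1 : ∀ x, Filter.Tendsto (fun n => γ n x) Filter.atTop (nhds 1))
    {k : ℕ → P → P → ENNReal}
    (hk : ∀ n, Measurable (Function.uncurry (k n))) (hsymm : ∀ n p q, k n p q = k n q p)
    (hK : ∀ n p q,
      ‖∫ x, Complex.exp (Complex.I * ((θ x p - θ x q : ℝ) : ℂ)) * (γ n x : ℂ) ∂ν‖ₑ ≤ k n p q)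
    {M : ENNReal} (hM : ∀ n p, ∫⁻ q, k n p q ∂μ ≤ M) {H : P → ℂ} (hH : StronglyMeasurable H) :
    ∫⁻ x, ‖∫ p, Complex.exp (Complex.I * (θ x p : ℂ)) * H p ∂μ‖ₑ ^ 2 ∂ν
      ≤ M * ∫⁻ p, ‖H p‖ₑ ^ 2 ∂μ := by
  have hF : StronglyMeasurable fun x => ∫ p, Complex.exp (Complex.I * (θ x p : ℂ)) * H p ∂μ := by
    have hθ2 : Measurable fun z : X × P => θ z.1 z.2 := hθ
    refine StronglyMeasurable.integral_prod_right
      (f := fun x p => Complex.exp (Complex.I * (θ x p : ℂ)) * H p) ?_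
    refine StronglyMeasurable.mul (Measurable.stronglyMeasurable ?_)
      (hH.comp_measurable measurable_snd)
    fun_prop
  have hFm := hF.measurable
  set F := fun x => ∫ p, Complex.exp (Complex.I * (θ x p : ℂ)) * H p ∂μ with hFdef
  have hlim : ∀ x, Filter.liminf (fun n => ‖F x‖ₑ ^ 2 * ENNReal.ofReal (γ n x)) Filter.atTop
      = ‖F x‖ₑ ^ 2 := by
    intro x
    refine Filter.Tendsto.liminf_eq ?_
    have := ENNReal.Tendsto.const_mul (a := ‖F x‖ₑ ^ 2) (ENNReal.tendsto_ofReal (hγ1 x))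
      (Or.inl (by simp))
    simpa using this
  calc ∫⁻ x, ‖F x‖ₑ ^ 2 ∂ν
      = ∫⁻ x, Filter.liminf (fun n => ‖F x‖ₑ ^ 2 * ENNReal.ofReal (γ n x)) Filter.atTop ∂ν := by
        simp_rw [hlim]
    _ ≤ Filter.liminf (fun n => ∫⁻ x, ‖F x‖ₑ ^ 2 * ENNReal.ofReal (γ n x) ∂ν) Filter.atTop := by
        refine lintegral_liminf_le fun n => ?_
        have := hγm n
        fun_prop
    _ ≤ M * ∫⁻ p, ‖H p‖ₑ ^ 2 ∂μ := by
        refine Filter.liminf_le_of_le (by isBoundedDefault) fun b hb => ?_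
        obtain ⟨n, hn⟩ := hb.exists
        exact hn.trans (lintegral_enorm_sq_oscillatory_mul_le hθ (hγ n) (hγ0 n) (hk n) (hsymm n)
          (hK n) (hM n) hH)

@[fun_prop]
lemma continuous_nsq {k : ℕ} : Continuous (nsq (k := k)) := by unfold nsq; fun_prop

@[fun_prop]
lemma Measurable.dotp {α : Type*} [MeasurableSpace α] {k : ℕ} {f g : α → ℝ × (Fin k → ℝ)}
    (hf : Measurable f) (hg : Measurable g) : Measurable fun a => dotp (f a) (g a) := by
  unfold _root_.dotp
  have h1 : ∀ i, Measurable fun a => (f a).2 i := fun i => (measurable_pi_apply i).comp hf.snd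
  have h2 : ∀ i, Measurable fun a => (g a).2 i := fun i => (measurable_pi_apply i).comp hg.snd
  fun_prop

lemma dotp_comm {k : ℕ} (x y : ℝ × (Fin k → ℝ)) : dotp x y = dotp y x := by
  simp only [dotp, mul_comm]

lemma dotp_sub {k : ℕ} (x y z : ℝ × (Fin k → ℝ)) : dotp x (y - z) = dotp x y - dotp x z := by
  simp only [dotp, Prod.fst_sub, Prod.snd_sub, Pi.sub_apply, mul_sub, Finset.sum_sub_distrib]
  ring

lemma integral_cexp_dotp_mul_gaussian {k : ℕ} {ε : ℝ} (hε : 0 < ε) (q : ℝ × (Fin k → ℝ)) :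
    ∫ x : ℝ × (Fin k → ℝ), Complex.exp (Complex.I * (dotp x q : ℂ)) *
        (Real.exp (-ε * nsq x) : ℝ) = ((gaussKer ε q.1 * gaussKerPi ε q.2 : ℝ) : ℂ) := by
  rw [Complex.ofReal_mul, ← integral_cexp_mul_gaussian hε, ← integral_cexp_mul_gaussian_pi hε,
    ← integral_prod_mul, Measure.volume_eq_prod]
  congr 1; ext x
  rw [dotp, nsq, mul_add, Real.exp_add, Complex.ofReal_add, mul_add, Complex.exp_add]
  push_cast
  ring

lemma integrable_exp_neg_mul_nsq {k : ℕ} {ε : ℝ} (hε : 0 < ε) :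
    Integrable fun x : ℝ × (Fin k → ℝ) => Real.exp (-ε * nsq x) := by
  refine ((integrable_exp_neg_mul_sq hε).mul_prod
    (integrable_exp_neg_mul_sum_sq (k := k) hε)).congr (Filter.Eventually.of_forall fun x => ?_)
  simp only [nsq, mul_add, Real.exp_add]

lemma tendsto_exp_neg_div_mul (a : ℝ) :
    Filter.Tendsto (fun n : ℕ => Real.exp (-(1 / ((n : ℝ) + 1)) * a)) Filter.atTop (nhds 1) := by
  have h := (tendsto_one_div_add_atTop_nhds_zero_nat (𝕜 := ℝ)).neg.mul_const a
  simpa [Function.comp_def] using (Real.continuous_exp.tendsto _).comp h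

lemma stronglyMeasurable_FT {k : ℕ} {u : ℝ × (Fin k → ℝ) → ℂ} (hu : StronglyMeasurable u) :
    StronglyMeasurable (FT u) := by
  refine StronglyMeasurable.integral_prod_right
    (f := fun ξ x => Complex.exp (-Complex.I * (dotp x ξ : ℂ)) * u x) ?_
  refine StronglyMeasurable.mul (Measurable.stronglyMeasurable ?_)
    (hu.comp_measurable measurable_snd)
  fun_prop

/-- The upper bound in Plancherel's theorem for `FT`. -/
lemma lintegral_enorm_sq_FT_le {k : ℕ} {u : ℝ × (Fin k → ℝ) → ℂ} (hu : StronglyMeasurable u) :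
    ∫⁻ ξ, ‖FT u ξ‖ₑ ^ 2 ≤ ENNReal.ofReal ((2 * Real.pi) ^ (k + 1)) * ∫⁻ x, ‖u x‖ₑ ^ 2 := by
  have hε : ∀ n : ℕ, (0 : ℝ) < 1 / ((n : ℝ) + 1) := fun n => by positivity
  have h := lintegral_enorm_sq_oscillatory_le (ν := (volume : Measure (ℝ × (Fin k → ℝ))))
    (μ := (volume : Measure (ℝ × (Fin k → ℝ)))) (θ := fun ξ x => -dotp x ξ)
    (by simp only [Function.uncurry_def]; fun_prop)
    (γ := fun n ξ => Real.exp (-(1 / ((n : ℝ) + 1)) * nsq ξ))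
    (fun n => integrable_exp_neg_mul_nsq (hε n)) (fun n => by fun_prop)
    (fun n ξ => (Real.exp_pos _).le) (fun ξ => tendsto_exp_neg_div_mul _)
    (k := fun n x y => ENNReal.ofReal (gaussKer (1 / ((n : ℝ) + 1)) (x.1 - y.1)) *
      ENNReal.ofReal (gaussKerPi (1 / ((n : ℝ) + 1)) (x.2 - y.2)))
    (fun n => by simp only [Function.uncurry_def]; fun_prop)
    (fun n x y => by rw [gaussKer_sub_comm, gaussKerPi_sub_comm])
    (fun n x y => by
      have e : ∀ ξ, -dotp x ξ - -dotp y ξ = dotp ξ (y - x) := fun ξ => by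
        rw [dotp_sub, dotp_comm ξ, dotp_comm ξ]; ring
      simp_rw [e]
      rw [integral_cexp_dotp_mul_gaussian (hε n), ← ofReal_norm, Complex.norm_real,
        Real.norm_of_nonneg (mul_nonneg (gaussKer_nonneg _ _) (gaussKerPi_nonneg _ _)),
        ENNReal.ofReal_mul (gaussKer_nonneg _ _), Prod.fst_sub, Prod.snd_sub, gaussKer_sub_comm,
        gaussKerPi_sub_comm])
    (M := ENNReal.ofReal ((2 * Real.pi) ^ (k + 1)))
    (fun n x => by
      rw [Measure.volume_eq_prod, lintegral_prod_mul
        (f := fun y => ENNReal.ofReal (gaussKer (1 / ((n : ℝ) + 1)) (x.1 - y)))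
        (g := fun y => ENNReal.ofReal (gaussKerPi (1 / ((n : ℝ) + 1)) (x.2 - y)))
        (by fun_prop) (by fun_prop), lintegral_gaussKerPi_sub (hε n),
        lintegral_sub_left_eq_self (fun y => ENNReal.ofReal (gaussKer (1 / ((n : ℝ) + 1)) y)),
        lintegral_gaussKer (hε n), ← ENNReal.ofReal_mul (by positivity), pow_succ'])
    hu
  simpa [FT] using h

lemma lintegral_prod_prod_eq {A B C D : Type*} [MeasurableSpace A] [MeasurableSpace B]
    [MeasurableSpace C] [MeasurableSpace D] {α : Measure A} {β : Measure B} {γ : Measure C}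
    {δ : Measure D} [SFinite α] [SFinite β] [SFinite γ] [SFinite δ]
    {f : (A × B) × (C × D) → ENNReal} (hf : Measurable f) :
    ∫⁻ z, f z ∂((α.prod β).prod (γ.prod δ))
      = ∫⁻ b, ∫⁻ d, ∫⁻ a, ∫⁻ c, f ((a, b), (c, d)) ∂γ ∂α ∂δ ∂β := by
  rw [lintegral_prod _ hf.aemeasurable, lintegral_prod_symm _ (by fun_prop)]
  refine lintegral_congr fun b => ?_
  rw [lintegral_lintegral_swap (f := fun d a => ∫⁻ c, f ((a, b), (c, d)) ∂γ)
    (by simp only [Function.uncurry_def]; fun_prop)]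
  exact lintegral_congr fun a => lintegral_prod_symm _ (by fun_prop)

lemma lintegral_resonance_kernel_le {c : ℝ} (hc : 1 < 2 * c) {ε : ℝ} (hε : 0 < ε) {m : ℝ}
    (hm : 0 ≤ m) (r s : ℝ) :
    ENNReal.ofReal (2 * c - 1) * ∫⁻ ζ : ℝ, ∫⁻ ξ in {ξ : ℝ | c ≤ |ξ|},
        ENNReal.ofReal (gaussKer ε (√(ζ ^ 2 + m) + ξ ^ 2 + r)) *
          ENNReal.ofReal (gaussKer ε (s - (ζ + ξ)))
      ≤ 2 * ENNReal.ofReal (2 * Real.pi) ^ 2 := by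
  have h1 : ∫⁻ ζ : ℝ, ∫⁻ ξ in {ξ : ℝ | c ≤ |ξ|},
        ENNReal.ofReal (gaussKer ε (√(ζ ^ 2 + m) + ξ ^ 2 + r)) *
          ENNReal.ofReal (gaussKer ε (s - (ζ + ξ)))
      = ∫⁻ σ : ℝ, ENNReal.ofReal (gaussKer ε (s - σ)) * ∫⁻ ξ in {ξ : ℝ | c ≤ |ξ|},
        ENNReal.ofReal (gaussKer ε (√((σ - ξ) ^ 2 + m) + ξ ^ 2 + r)) := by
    rw [lintegral_lintegral_swap (by simp only [Function.uncurry_def]; fun_prop)]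
    have h2 : ∀ ξ : ℝ, ∫⁻ ζ : ℝ, ENNReal.ofReal (gaussKer ε (√(ζ ^ 2 + m) + ξ ^ 2 + r)) *
          ENNReal.ofReal (gaussKer ε (s - (ζ + ξ)))
        = ∫⁻ σ : ℝ, ENNReal.ofReal (gaussKer ε (s - σ)) *
          ENNReal.ofReal (gaussKer ε (√((σ - ξ) ^ 2 + m) + ξ ^ 2 + r)) := by
      intro ξ
      rw [← lintegral_sub_right_eq_self _ ξ]
      simp only [sub_add_cancel, mul_comm]
    simp_rw [h2]
    rw [lintegral_lintegral_swap (by simp only [Function.uncurry_def]; fun_prop)]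
    exact lintegral_congr fun σ => lintegral_const_mul' _ _ ENNReal.ofReal_ne_top
  rw [h1, ← lintegral_const_mul' _ _ ENNReal.ofReal_ne_top]
  calc ∫⁻ σ : ℝ, ENNReal.ofReal (2 * c - 1) * (ENNReal.ofReal (gaussKer ε (s - σ)) *
        ∫⁻ ξ in {ξ : ℝ | c ≤ |ξ|}, ENNReal.ofReal (gaussKer ε (√((σ - ξ) ^ 2 + m) + ξ ^ 2 + r)))
      ≤ ∫⁻ σ : ℝ, 2 * ENNReal.ofReal (2 * Real.pi) * ENNReal.ofReal (gaussKer ε (s - σ)) := by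
        refine lintegral_mono fun σ => ?_
        have h3 := setLIntegral_resonance_le hc σ hm fun u => ENNReal.ofReal (gaussKer ε (u + r))
        rw [lintegral_add_right_eq_self (fun u => ENNReal.ofReal (gaussKer ε u)),
          lintegral_gaussKer hε] at h3
        rw [mul_left_comm, mul_comm _ (ENNReal.ofReal (gaussKer ε (s - σ)))]
        gcongr
    _ = 2 * ENNReal.ofReal (2 * Real.pi) ^ 2 := by
        rw [lintegral_const_mul _ (by fun_prop),
          lintegral_sub_left_eq_self (fun u => ENNReal.ofReal (gaussKer ε u)),
          lintegral_gaussKer hε]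
        ring

/-- The pair `(-(|ξ| + |ξ'|²), η)` dual to `(t, y)` in the phase of a product of a half-wave at
frequency `ξ = (ξ₁, η)` and a Schrödinger wave at frequency `ξ'`. -/
def timeFreq {k : ℕ} (p : (ℝ × (Fin k → ℝ)) × (ℝ × (Fin k → ℝ))) : ℝ × (Fin k → ℝ) :=
  (-(√(nsq p.1) + nsq p.2), p.1.2)

/-- The pair `(ξ₁ + ξ'₁, η')` dual to `(x₁, y')` in the phase of a product of a half-wave at
frequency `ξ` and a Schrödinger wave at frequency `ξ' = (ξ'₁, η')`. -/
def spaceFreq {k : ℕ} (p : (ℝ × (Fin k → ℝ)) × (ℝ × (Fin k → ℝ))) : ℝ × (Fin k → ℝ) :=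
  (p.1.1 + p.2.1, p.2.2)

@[fun_prop]
lemma continuous_timeFreq {k : ℕ} : Continuous (timeFreq (k := k)) := by
  unfold timeFreq; fun_prop

@[fun_prop]
lemma continuous_spaceFreq {k : ℕ} : Continuous (spaceFreq (k := k)) := by
  unfold spaceFreq; fun_prop

/-- The tensor kernel on `ℝ × ℝ^k`. -/
def gaussKerProd {k : ℕ} (ε : ℝ) (q : ℝ × (Fin k → ℝ)) : ℝ := gaussKer ε q.1 * gaussKerPi ε q.2

lemma gaussKerProd_nonneg {k : ℕ} (ε : ℝ) (q : ℝ × (Fin k → ℝ)) : 0 ≤ gaussKerProd ε q :=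
  mul_nonneg (gaussKer_nonneg _ _) (gaussKerPi_nonneg _ _)

lemma gaussKerProd_sub_comm {k : ℕ} (ε : ℝ) (p q : ℝ × (Fin k → ℝ)) :
    gaussKerProd ε (p - q) = gaussKerProd ε (q - p) := by
  simp only [gaussKerProd, Prod.fst_sub, Prod.snd_sub]
  rw [gaussKer_sub_comm, gaussKerPi_sub_comm]

@[fun_prop]
lemma continuous_gaussKerProd {k : ℕ} (ε : ℝ) : Continuous (gaussKerProd (k := k) ε) := by
  unfold gaussKerProd; fun_prop

lemma lintegral_gaussKerProd_freq_le {k : ℕ} {c : ℝ} (hc : 1 < 2 * c) {ε : ℝ} (hε : 0 < ε)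
    (p : (ℝ × (Fin k → ℝ)) × (ℝ × (Fin k → ℝ))) :
    ∫⁻ q, ENNReal.ofReal (gaussKerProd ε (timeFreq p - timeFreq q)) *
        ENNReal.ofReal (gaussKerProd ε (spaceFreq p - spaceFreq q))
      ∂((volume : Measure (ℝ × (Fin k → ℝ))).prod
        ((volume.restrict {ξ : ℝ | c ≤ |ξ|}).prod (volume : Measure (Fin k → ℝ))))
      ≤ 2 * ENNReal.ofReal (2 * Real.pi) ^ 2 * ENNReal.ofReal ((2 * Real.pi) ^ k) ^ 2 /
        ENNReal.ofReal (2 * c - 1) := by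
  have hc0 : ENNReal.ofReal (2 * c - 1) ≠ 0 := by
    rw [Ne, ENNReal.ofReal_eq_zero, not_le]; linarith
  rw [ENNReal.le_div_iff_mul_le (Or.inl hc0) (Or.inl ENNReal.ofReal_ne_top), mul_comm,
    Measure.volume_eq_prod, lintegral_prod_prod_eq (by fun_prop)]
  have key : ∀ η ω : Fin k → ℝ, ENNReal.ofReal (2 * c - 1) *
      ∫⁻ ζ : ℝ, ∫⁻ ξ in {ξ : ℝ | c ≤ |ξ|},
        ENNReal.ofReal (gaussKerProd ε (timeFreq p - timeFreq ((ζ, η), (ξ, ω)))) *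
        ENNReal.ofReal (gaussKerProd ε (spaceFreq p - spaceFreq ((ζ, η), (ξ, ω))))
      ≤ 2 * ENNReal.ofReal (2 * Real.pi) ^ 2 * (ENNReal.ofReal (gaussKerPi ε (p.1.2 - η)) *
        ENNReal.ofReal (gaussKerPi ε (p.2.2 - ω))) := by
    intro η ω
    have h := lintegral_resonance_kernel_le hc hε (m := ∑ i, η i ^ 2) (by positivity)
      (∑ i, ω i ^ 2 - (√(nsq p.1) + nsq p.2)) (p.1.1 + p.2.1)
    have e : ∀ ζ ξ : ℝ,
        ENNReal.ofReal (gaussKerProd ε (timeFreq p - timeFreq ((ζ, η), (ξ, ω)))) *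
        ENNReal.ofReal (gaussKerProd ε (spaceFreq p - spaceFreq ((ζ, η), (ξ, ω))))
        = (ENNReal.ofReal (gaussKerPi ε (p.1.2 - η)) * ENNReal.ofReal (gaussKerPi ε (p.2.2 - ω))) *
          (ENNReal.ofReal (gaussKer ε (√(ζ ^ 2 + ∑ i, η i ^ 2) + ξ ^ 2 +
            (∑ i, ω i ^ 2 - (√(nsq p.1) + nsq p.2)))) *
          ENNReal.ofReal (gaussKer ε (p.1.1 + p.2.1 - (ζ + ξ)))) := by
      intro ζ ξ
      simp only [gaussKerProd, timeFreq, spaceFreq, Prod.fst_sub, Prod.snd_sub]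
      rw [ENNReal.ofReal_mul (gaussKer_nonneg _ _), ENNReal.ofReal_mul (gaussKer_nonneg _ _)]
      have e2 : -(√(nsq p.1) + nsq p.2) - -(√(nsq (ζ, η)) + nsq (ξ, ω))
          = √(ζ ^ 2 + ∑ i, η i ^ 2) + ξ ^ 2 + (∑ i, ω i ^ 2 - (√(nsq p.1) + nsq p.2)) := by
        simp only [nsq]; ring
      rw [e2]
      ring
    simp_rw [e]
    have hfin : ENNReal.ofReal (gaussKerPi ε (p.1.2 - η)) *
        ENNReal.ofReal (gaussKerPi ε (p.2.2 - ω)) ≠ ⊤ :=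
      ENNReal.mul_ne_top ENNReal.ofReal_ne_top ENNReal.ofReal_ne_top
    simp_rw [lintegral_const_mul' _ _ hfin]
    rw [mul_left_comm, mul_comm (2 * _)]
    gcongr
  simp_rw [← lintegral_const_mul' _ _ (ENNReal.ofReal_ne_top (r := 2 * c - 1))]
  simp_rw [← lintegral_const_mul' _ _ (ENNReal.ofReal_ne_top (r := 2 * c - 1))] at key
  calc _ ≤ ∫⁻ η : Fin k → ℝ, ∫⁻ ω : Fin k → ℝ, 2 * ENNReal.ofReal (2 * Real.pi) ^ 2 *
        (ENNReal.ofReal (gaussKerPi ε (p.1.2 - η)) * ENNReal.ofReal (gaussKerPi ε (p.2.2 - ω))) :=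
        lintegral_mono fun η => lintegral_mono fun ω => key η ω
    _ = _ := by
        simp_rw [← mul_assoc, lintegral_const_mul' _ _ (ENNReal.mul_ne_top
          (ENNReal.mul_ne_top ENNReal.ofNat_ne_top (ENNReal.pow_ne_top ENNReal.ofReal_ne_top))
          ENNReal.ofReal_ne_top), lintegral_gaussKerPi_sub hε]
        rw [lintegral_mul_const' _ _ ENNReal.ofReal_ne_top, lintegral_const_mul' _ _
          (ENNReal.mul_ne_top ENNReal.ofNat_ne_top (ENNReal.pow_ne_top ENNReal.ofReal_ne_top)),
          lintegral_gaussKerPi_sub hε]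
        ring

/-- Bilinear `L²` bound for the product operator with the Schrödinger frequency restricted to
`|ξ'₁| ≥ c`, in the variables `X = ((t, y), (x₁, y'))`. -/
lemma lintegral_enorm_sq_bilinear_le {k : ℕ} {c : ℝ} (hc : 1 < 2 * c)
    {H : (ℝ × (Fin k → ℝ)) × (ℝ × (Fin k → ℝ)) → ℂ} (hH : StronglyMeasurable H)
    (hH0 : ∀ p, |p.2.1| < c → H p = 0) :
    ∫⁻ X : (ℝ × (Fin k → ℝ)) × (ℝ × (Fin k → ℝ)), ‖∫ p, Complex.exp (Complex.I *
        ((dotp X.1 (timeFreq p) + dotp X.2 (spaceFreq p) : ℝ) : ℂ)) * H p‖ₑ ^ 2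
      ≤ 2 * ENNReal.ofReal (2 * Real.pi) ^ 2 * ENNReal.ofReal ((2 * Real.pi) ^ k) ^ 2 /
        ENNReal.ofReal (2 * c - 1) * ∫⁻ p, ‖H p‖ₑ ^ 2 := by
  have hε : ∀ n : ℕ, (0 : ℝ) < 1 / ((n : ℝ) + 1) := fun n => by positivity
  have hμ : ((volume : Measure (ℝ × (Fin k → ℝ))).prod
      ((volume.restrict {ξ : ℝ | c ≤ |ξ|}).prod (volume : Measure (Fin k → ℝ))))
      = volume.restrict (Set.univ ×ˢ ({ξ : ℝ | c ≤ |ξ|} ×ˢ Set.univ)) := by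
    rw [Measure.volume_eq_prod (ℝ × (Fin k → ℝ)) (ℝ × (Fin k → ℝ)), ← Measure.prod_restrict,
      Measure.restrict_univ, Measure.volume_eq_prod ℝ (Fin k → ℝ), ← Measure.prod_restrict,
      Measure.restrict_univ]
  have h := lintegral_enorm_sq_oscillatory_le
    (ν := (volume : Measure ((ℝ × (Fin k → ℝ)) × (ℝ × (Fin k → ℝ)))))
    (μ := (volume : Measure (ℝ × (Fin k → ℝ))).prod
      ((volume.restrict {ξ : ℝ | c ≤ |ξ|}).prod (volume : Measure (Fin k → ℝ))))
    (θ := fun X p => dotp X.1 (timeFreq p) + dotp X.2 (spaceFreq p))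
    (by simp only [Function.uncurry_def]; fun_prop)
    (γ := fun n X => Real.exp (-(1 / ((n : ℝ) + 1)) * nsq X.1) *
      Real.exp (-(1 / ((n : ℝ) + 1)) * nsq X.2))
    (fun n => (integrable_exp_neg_mul_nsq (hε n)).mul_prod (integrable_exp_neg_mul_nsq (hε n)))
    (fun n => by fun_prop) (fun n X => mul_nonneg (Real.exp_pos _).le (Real.exp_pos _).le)
    (fun X => by
      simpa using (tendsto_exp_neg_div_mul (nsq X.1)).mul (tendsto_exp_neg_div_mul (nsq X.2)))
    (k := fun n p q =>
      ENNReal.ofReal (gaussKerProd (1 / ((n : ℝ) + 1)) (timeFreq p - timeFreq q)) *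
      ENNReal.ofReal (gaussKerProd (1 / ((n : ℝ) + 1)) (spaceFreq p - spaceFreq q)))
    (fun n => by simp only [Function.uncurry_def]; fun_prop)
    (fun n p q => by
      rw [gaussKerProd_sub_comm, gaussKerProd_sub_comm _ (spaceFreq p)])
    (fun n p q => by
      rw [← ENNReal.ofReal_mul (gaussKerProd_nonneg _ _), ← Real.norm_of_nonneg
        (mul_nonneg (gaussKerProd_nonneg _ (timeFreq p - timeFreq q))
          (gaussKerProd_nonneg (1 / ((n : ℝ) + 1)) (spaceFreq p - spaceFreq q))),
        ← Complex.norm_real, ofReal_norm, Complex.ofReal_mul, gaussKerProd, gaussKerProd,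
        ← integral_cexp_dotp_mul_gaussian (hε n), ← integral_cexp_dotp_mul_gaussian (hε n),
        ← integral_prod_mul, Measure.volume_eq_prod (ℝ × (Fin k → ℝ)) (ℝ × (Fin k → ℝ))]
      refine le_of_eq (congrArg _ (congrArg _ (funext fun X => ?_)))
      rw [dotp_sub, dotp_sub, mul_mul_mul_comm, ← Complex.exp_add, ← mul_add]
      congr 3
      · push_cast; ring
      · push_cast; rfl)
    (fun n p => lintegral_gaussKerProd_freq_le hc (hε n) p) hH
  rw [hμ] at h
  have e : ∀ X : (ℝ × (Fin k → ℝ)) × (ℝ × (Fin k → ℝ)),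
      ∫ p in (Set.univ ×ˢ ({ξ : ℝ | c ≤ |ξ|} ×ˢ Set.univ)), Complex.exp (Complex.I *
        ((dotp X.1 (timeFreq p) + dotp X.2 (spaceFreq p) : ℝ) : ℂ)) * H p
      = ∫ p, Complex.exp (Complex.I *
        ((dotp X.1 (timeFreq p) + dotp X.2 (spaceFreq p) : ℝ) : ℂ)) * H p := by
    intro X
    refine setIntegral_eq_integral_of_forall_compl_eq_zero fun p hp => ?_
    rw [hH0 p (by simpa using hp), mul_zero]
  simp_rw [e] at h
  refine h.trans ?_
  gcongr
  exact Measure.restrict_le_self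

lemma le_abs_fst_of_inA_of_inCone {k : ℕ} {mu : ℝ} (hmu : 0 ≤ mu) {ξ : ℝ × (Fin k → ℝ)}
    (hA : inA mu ξ) (hC : inCone ξ) : 4 * mu / 5 ≤ |ξ.1| := by
  have hS : 0 ≤ ∑ i, ξ.2 i ^ 2 := by positivity
  have h1 : (8 * mu / 9) ^ 2 ≤ ξ.1 ^ 2 + ∑ i, ξ.2 i ^ 2 := by
    have := pow_le_pow_left₀ (by positivity) hA.1 2
    rwa [nsq, Real.sq_sqrt (by positivity)] at this
  have h2 : 100 ^ 2 * ∑ i, ξ.2 i ^ 2 ≤ ξ.1 ^ 2 := by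
    have := pow_le_pow_left₀ (by positivity) hC 2
    rwa [mul_pow, Real.sq_sqrt hS, sq_abs] at this
  refine abs_le_of_sq_le_sq' ?_ (abs_nonneg _) |>.2
  rw [sq_abs]
  nlinarith

lemma halfWaveEvol_mul_schrodingerEvol {k : ℕ} (v E : ℝ × (Fin k → ℝ) → ℂ) (t x : ℝ)
    (y z : Fin k → ℝ) :
    halfWaveEvol v t (x, y) * schrodingerEvol E t (x, z)
      = (((((2 * Real.pi) ^ (k + 1) : ℝ)⁻¹) ^ 2 : ℝ) : ℂ) * ∫ p, Complex.exp (Complex.I *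
        ((dotp (t, y) (timeFreq p) + dotp (x, z) (spaceFreq p) : ℝ) : ℂ)) *
          (FT v p.1 * FT E p.2) := by
  rw [halfWaveEvol, schrodingerEvol, Complex.real_smul, Complex.real_smul, mul_mul_mul_comm,
    ← integral_prod_mul, Measure.volume_eq_prod (ℝ × (Fin k → ℝ)) (ℝ × (Fin k → ℝ)),
    ← Complex.ofReal_mul, sq]
  congr 2
  ext p
  rw [mul_mul_mul_comm, ← Complex.exp_add]
  congr 2
  simp only [dotp, timeFreq, spaceFreq]
  push_cast
  ring

lemma measurable_halfWaveEvol {k : ℕ} {v : ℝ × (Fin k → ℝ) → ℂ} (hv : StronglyMeasurable v) :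
    Measurable fun z : ℝ × (ℝ × (Fin k → ℝ)) => halfWaveEvol v z.1 z.2 := by
  refine ((StronglyMeasurable.integral_prod_right (ν := (volume : Measure (ℝ × (Fin k → ℝ))))
    (f := fun (z : ℝ × (ℝ × (Fin k → ℝ))) ξ => Complex.exp (Complex.I * (dotp z.2 ξ : ℂ) -
      Complex.I * (z.1 : ℂ) * (√(nsq ξ) : ℂ)) * FT v ξ) ?_).const_smul
        (((2 * Real.pi) ^ (k + 1) : ℝ)⁻¹)).measurable
  refine StronglyMeasurable.mul (Measurable.stronglyMeasurable ?_)
    ((stronglyMeasurable_FT hv).comp_measurable measurable_snd)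
  fun_prop

lemma measurable_schrodingerEvol {k : ℕ} {E : ℝ × (Fin k → ℝ) → ℂ} (hE : StronglyMeasurable E) :
    Measurable fun z : ℝ × (ℝ × (Fin k → ℝ)) => schrodingerEvol E z.1 z.2 := by
  refine ((StronglyMeasurable.integral_prod_right (ν := (volume : Measure (ℝ × (Fin k → ℝ))))
    (f := fun (z : ℝ × (ℝ × (Fin k → ℝ))) ξ => Complex.exp (Complex.I * (dotp z.2 ξ : ℂ) -
      Complex.I * (z.1 : ℂ) * (nsq ξ : ℂ)) * FT E ξ) ?_).const_smul
        (((2 * Real.pi) ^ (k + 1) : ℝ)⁻¹)).measurable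
  refine StronglyMeasurable.mul (Measurable.stronglyMeasurable ?_)
    ((stronglyMeasurable_FT hE).comp_measurable measurable_snd)
  fun_prop

lemma sq_lintegral_mul_le {α : Type*} [MeasurableSpace α] {μ : Measure α} {f g : α → ENNReal}
    (hf : Measurable f) (hg : Measurable g) :
    (∫⁻ a, f a * g a ∂μ) ^ 2 ≤ (∫⁻ a, f a ^ 2 ∂μ) * ∫⁻ a, g a ^ 2 ∂μ := by
  have h := ENNReal.lintegral_mul_le_Lp_mul_Lq μ Real.HolderConjugate.two_two
    hf.aemeasurable hg.aemeasurable
  calc (∫⁻ a, f a * g a ∂μ) ^ 2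
      ≤ ((∫⁻ a, f a ^ (2 : ℝ) ∂μ) ^ (1 / 2 : ℝ) * (∫⁻ a, g a ^ (2 : ℝ) ∂μ) ^ (1 / 2 : ℝ)) ^ 2 :=
        pow_le_pow_left₀ zero_le h 2
    _ = _ := by
        rw [mul_pow, ← ENNReal.rpow_natCast, ← ENNReal.rpow_natCast, ← ENNReal.rpow_mul,
          ← ENNReal.rpow_mul]
        norm_num

lemma lintegral_enorm_sq_eq_ofReal {k : ℕ} (u : SchwartzMap (ℝ × (Fin k → ℝ)) ℂ) :
    ∫⁻ x, ‖u x‖ₑ ^ 2 = ENNReal.ofReal (∫ x, ‖u x‖ ^ 2) := by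
  rw [ofReal_integral_eq_lintegral_ofReal]
  · refine lintegral_congr fun x => ?_
    rw [ENNReal.ofReal_pow (norm_nonneg _), ofReal_norm]
  · have : (volume : Measure (ℝ × (Fin k → ℝ))).IsAddHaarMeasure :=
      inferInstanceAs ((volume : Measure ℝ).prod (volume : Measure (Fin k → ℝ))).IsAddHaarMeasure
    exact (u.memLp 2).integrable_norm_pow two_ne_zero
  · exact Filter.Eventually.of_forall fun x => by positivity

lemma lintegral_sq_lintegral_mul_le {T A B : Type*} [MeasurableSpace T] [MeasurableSpace A]
    [MeasurableSpace B] {τ : Measure T} {α : Measure A} {β : Measure B} [SFinite τ] [SFinite α]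
    [SFinite β] {f g : T × (A × B) → ENNReal} (hf : Measurable f) (hg : Measurable g) :
    ∫⁻ t, ∫⁻ x, (∫⁻ y, f (t, (x, y)) * g (t, (x, y)) ∂β) ^ 2 ∂α ∂τ
      ≤ ∫⁻ X : (T × B) × (A × B), (f (X.1.1, (X.2.1, X.1.2)) * g (X.1.1, (X.2.1, X.2.2))) ^ 2
        ∂((τ.prod β).prod (α.prod β)) := by
  rw [lintegral_prod _ (by fun_prop), lintegral_prod _ (by fun_prop)]
  refine lintegral_mono fun t => ?_
  have h : ∀ y : B, ∫⁻ w : A × B, (f (t, (w.1, y)) * g (t, (w.1, w.2))) ^ 2 ∂(α.prod β)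
      = ∫⁻ x, ∫⁻ z, (f (t, (x, y)) * g (t, (x, z))) ^ 2 ∂β ∂α :=
    fun y => lintegral_prod _ (by fun_prop)
  simp only [h]
  rw [lintegral_lintegral_swap (by simp only [Function.uncurry_def]; fun_prop)]
  refine lintegral_mono fun x => ?_
  refine (sq_lintegral_mul_le (by fun_prop) (by fun_prop)).trans (le_of_eq ?_)
  simp_rw [mul_pow]
  rw [← lintegral_mul_const _ (by fun_prop)]
  exact lintegral_congr fun y => (lintegral_const_mul _ (by fun_prop)).symm

lemma enorm_integral_sq_mul_le {k : ℕ} {mu : ℝ} (hmu : 1 ≤ mu)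
    (v E : SchwartzMap (ℝ × (Fin k → ℝ)) ℂ)
    (hE : ∀ ξ : ℝ × (Fin k → ℝ), ¬ (inA mu ξ ∧ inCone ξ) → FT (⇑E) ξ = 0) (s : Set ℝ) :
    ‖∫ t in s, ∫ x : ℝ, (∫ y : Fin k → ℝ,
        ‖halfWaveEvol (⇑v) t (x, y) * schrodingerEvol (⇑E) t (x, y)‖) ^ 2‖ₑ
      ≤ ENNReal.ofReal (2 ^ 2 * mu⁻¹ * (∫ x, ‖E x‖ ^ 2) * ∫ x, ‖v x‖ ^ 2) := by
  have sv : StronglyMeasurable (⇑v) := v.continuous.stronglyMeasurable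
  have sE : StronglyMeasurable (⇑E) := E.continuous.stronglyMeasurable
  have sFv := stronglyMeasurable_FT sv
  have sFE := stronglyMeasurable_FT sE
  set D : ℝ := (2 * Real.pi) ^ (k + 1) with hD
  have hD0 : 0 < D := by positivity
  have hFv : ∫⁻ ξ, ‖FT v ξ‖ₑ ^ 2 ≤ ENNReal.ofReal (D * ∫ x, ‖v x‖ ^ 2) := by
    rw [ENNReal.ofReal_mul hD0.le, ← lintegral_enorm_sq_eq_ofReal]
    exact lintegral_enorm_sq_FT_le sv
  have hFE : ∫⁻ ξ, ‖FT E ξ‖ₑ ^ 2 ≤ ENNReal.ofReal (D * ∫ x, ‖E x‖ ^ 2) := by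
    rw [ENNReal.ofReal_mul hD0.le, ← lintegral_enorm_sq_eq_ofReal]
    exact lintegral_enorm_sq_FT_le sE
  have hIE : 0 ≤ ∫ x, ‖E x‖ ^ 2 := integral_nonneg fun x => by positivity
  have hIv : 0 ≤ ∫ x, ‖v x‖ ^ 2 := integral_nonneg fun x => by positivity
  have hc : 1 < 2 * (4 * mu / 5) := by linarith
  have hbil := lintegral_enorm_sq_bilinear_le hc
    (H := fun p : (ℝ × (Fin k → ℝ)) × (ℝ × (Fin k → ℝ)) => FT v p.1 * FT E p.2)
    ((sFv.comp_measurable measurable_fst).mul (sFE.comp_measurable measurable_snd))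
    (fun p hp => by
      rw [hE p.2 fun h => hp.not_ge (le_abs_fst_of_inA_of_inCone (by linarith) h.1 h.2), mul_zero])
  have hprod : ∫⁻ p : (ℝ × (Fin k → ℝ)) × (ℝ × (Fin k → ℝ)), ‖FT v p.1 * FT E p.2‖ₑ ^ 2
      = (∫⁻ ξ, ‖FT v ξ‖ₑ ^ 2) * ∫⁻ ξ, ‖FT E ξ‖ₑ ^ 2 := by
    simp_rw [enorm_mul, mul_pow]
    exact lintegral_prod_mul (sFv.measurable.enorm.pow_const 2).aemeasurable
      (sFE.measurable.enorm.pow_const 2).aemeasurable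
  calc ‖∫ t in s, ∫ x : ℝ, (∫ y : Fin k → ℝ,
        ‖halfWaveEvol (⇑v) t (x, y) * schrodingerEvol (⇑E) t (x, y)‖) ^ 2‖ₑ
      ≤ ∫⁻ t in s, ‖∫ x : ℝ, (∫ y : Fin k → ℝ,
        ‖halfWaveEvol (⇑v) t (x, y) * schrodingerEvol (⇑E) t (x, y)‖) ^ 2‖ₑ :=
        enorm_integral_le_lintegral_enorm _
    _ ≤ ∫⁻ t : ℝ, ‖∫ x : ℝ, (∫ y : Fin k → ℝ,
        ‖halfWaveEvol (⇑v) t (x, y) * schrodingerEvol (⇑E) t (x, y)‖) ^ 2‖ₑ :=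
        setLIntegral_le_lintegral _ _
    _ ≤ ∫⁻ t : ℝ, ∫⁻ x : ℝ, (∫⁻ y : Fin k → ℝ,
        ‖halfWaveEvol (⇑v) t (x, y) * schrodingerEvol (⇑E) t (x, y)‖ₑ) ^ 2 := by
        refine lintegral_mono fun t => (enorm_integral_le_lintegral_enorm _).trans
          (lintegral_mono fun x => ?_)
        rw [enorm_pow]
        gcongr
        refine (enorm_integral_le_lintegral_enorm _).trans_eq ?_
        simp_rw [enorm_norm]
    _ ≤ ∫⁻ X : (ℝ × (Fin k → ℝ)) × (ℝ × (Fin k → ℝ)),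
        (‖halfWaveEvol v X.1.1 (X.2.1, X.1.2)‖ₑ * ‖schrodingerEvol E X.1.1 (X.2.1, X.2.2)‖ₑ) ^ 2 := by
        simp_rw [enorm_mul]
        exact lintegral_sq_lintegral_mul_le (measurable_halfWaveEvol sv).enorm
          (measurable_schrodingerEvol sE).enorm
    _ = ENNReal.ofReal ((D⁻¹) ^ 2) ^ 2 * ∫⁻ X : (ℝ × (Fin k → ℝ)) × (ℝ × (Fin k → ℝ)),
        ‖∫ p, Complex.exp (Complex.I * ((dotp X.1 (timeFreq p) + dotp X.2 (spaceFreq p) : ℝ) : ℂ)) *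
          (FT v p.1 * FT E p.2)‖ₑ ^ 2 := by
        rw [← lintegral_const_mul' _ _ (ENNReal.pow_ne_top ENNReal.ofReal_ne_top)]
        refine lintegral_congr fun X => ?_
        rw [← enorm_mul, halfWaveEvol_mul_schrodingerEvol, enorm_mul, mul_pow, ← ofReal_norm,
          Complex.norm_real, Real.norm_of_nonneg (by positivity)]
    _ ≤ ENNReal.ofReal ((D⁻¹) ^ 2) ^ 2 * (2 * ENNReal.ofReal (2 * Real.pi) ^ 2 *
        ENNReal.ofReal ((2 * Real.pi) ^ k) ^ 2 / ENNReal.ofReal (2 * (4 * mu / 5) - 1) *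
        (ENNReal.ofReal (D * ∫ x, ‖v x‖ ^ 2) * ENNReal.ofReal (D * ∫ x, ‖E x‖ ^ 2))) := by
        rw [hprod] at hbil
        gcongr
        refine hbil.trans ?_
        gcongr
    _ = ENNReal.ofReal (((D⁻¹) ^ 2) ^ 2 * (2 * (2 * Real.pi) ^ 2 * ((2 * Real.pi) ^ k) ^ 2 /
        (2 * (4 * mu / 5) - 1) * ((D * ∫ x, ‖v x‖ ^ 2) * (D * ∫ x, ‖E x‖ ^ 2)))) := by
        have hpos : 0 < 2 * (4 * mu / 5) - 1 := by linarith
        have hr : 0 ≤ 2 * Real.pi := by positivity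
        generalize 2 * Real.pi = r at hr ⊢
        generalize ∫ x, ‖v x‖ ^ 2 = a at hIv ⊢
        generalize ∫ x, ‖E x‖ ^ 2 = b at hIE ⊢
        rw [ENNReal.ofReal_mul (p := (D⁻¹ ^ 2) ^ 2) (by positivity),
          ENNReal.ofReal_mul (p := _ / _) (by positivity),
          ENNReal.ofReal_mul (p := D * a) (by positivity), ENNReal.ofReal_div_of_pos hpos,
          ENNReal.ofReal_mul (p := 2 * r ^ 2) (by positivity),
          ENNReal.ofReal_mul (p := 2) (q := r ^ 2) (by positivity),
          ENNReal.ofReal_pow (p := (D⁻¹) ^ 2) (by positivity), ENNReal.ofReal_pow (p := r) hr 2,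
          ENNReal.ofReal_pow (p := r ^ k) (by positivity), ENNReal.ofReal_ofNat]
    _ ≤ _ := by
        refine ENNReal.ofReal_le_ofReal ?_
        have e1 : (2 * Real.pi) ^ 2 * ((2 * Real.pi) ^ k) ^ 2 = D ^ 2 := by
          rw [hD]; ring
        have hpos : 0 < 2 * (4 * mu / 5) - 1 := by linarith
        have e2 : ((D⁻¹) ^ 2) ^ 2 * (2 * (2 * Real.pi) ^ 2 * ((2 * Real.pi) ^ k) ^ 2 /
            (2 * (4 * mu / 5) - 1) * ((D * ∫ x, ‖v x‖ ^ 2) * (D * ∫ x, ‖E x‖ ^ 2)))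
            = 2 / (2 * (4 * mu / 5) - 1) * (∫ x, ‖E x‖ ^ 2) * ∫ x, ‖v x‖ ^ 2 := by
          rw [mul_assoc 2, e1]
          field_simp
        rw [e2]
        gcongr
        rw [← div_eq_mul_inv, div_le_div_iff₀ hpos (by linarith)]
        linarith

/-- **Bilinear half-wave–Schrödinger estimate, high Schrödinger frequency.** For every dimension
`d = k + 1 ≥ 2` there are `C > 0` and `μ₀ ≥ 1` such that for `λ ≥ 1`, `μ ≥ μ₀`, half-wave datum
`v₀` with Fourier support in the ball `{|ξ| ≤ 9λ/4}` and Schrödinger datum `E₀` with Fourier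
support in `A_μ ∩ {|ξ₁| ≥ 100|ξ'|}`, for all `T > 0`:
`‖vE‖_{L²_t L²_{x₁} L¹_y} ≤ C μ^{-1/2} ‖E₀‖_{L²} ‖v₀‖_{L²}`. -/
theorem bilinear_halfwave_high_E (k : ℕ) (hk : 1 ≤ k) :
    ∃ C : ℝ, 0 < C ∧ ∃ μ₀ : ℝ, 1 ≤ μ₀ ∧
      ∀ (lam mu : ℝ), 1 ≤ lam → μ₀ ≤ mu →
      ∀ (v₀ E₀ : SchwartzMap (ℝ × (Fin k → ℝ)) ℂ),
        (∀ ξ : ℝ × (Fin k → ℝ), ¬ (Real.sqrt (nsq ξ) ≤ 9 * lam / 4) → FT (⇑v₀) ξ = 0) →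
        (∀ ξ : ℝ × (Fin k → ℝ), ¬ (inA mu ξ ∧ inCone ξ) → FT (⇑E₀) ξ = 0) →
        ∀ T : ℝ, 0 < T →
        (∫ t in Set.Icc (0:ℝ) T, ∫ x₁ : ℝ,
            (∫ y : Fin k → ℝ,
              ‖halfWaveEvol (⇑v₀) t (x₁, y) * schrodingerEvol (⇑E₀) t (x₁, y)‖) ^ 2)
          ^ ((1:ℝ)/2) ≤
          C * mu ^ (-(1:ℝ)/2) * (∫ x : ℝ × (Fin k → ℝ), ‖E₀ x‖ ^ 2) ^ ((1:ℝ)/2) *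
            (∫ x : ℝ × (Fin k → ℝ), ‖v₀ x‖ ^ 2) ^ ((1:ℝ)/2) := by
  refine ⟨2, by norm_num, 1, le_rfl, ?_⟩
  intro lam mu _ hmu v₀ E₀ _ hE T _
  have hμ0 : 0 < mu := by linarith
  have hbase := enorm_integral_sq_mul_le (mu := mu) hmu v₀ E₀ hE (Set.Icc 0 T)
  set B := ∫ t in Set.Icc (0 : ℝ) T, ∫ x₁ : ℝ, (∫ y : Fin k → ℝ,
    ‖halfWaveEvol (⇑v₀) t (x₁, y) * schrodingerEvol (⇑E₀) t (x₁, y)‖) ^ 2 with hB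
  have hB0 : 0 ≤ B := integral_nonneg fun t => integral_nonneg fun x => by positivity
  have hIE : 0 ≤ ∫ x, ‖E₀ x‖ ^ 2 := integral_nonneg fun x => by positivity
  have hIv : 0 ≤ ∫ x, ‖v₀ x‖ ^ 2 := integral_nonneg fun x => by positivity
  rw [Real.enorm_eq_ofReal hB0, ENNReal.ofReal_le_ofReal_iff (by positivity)] at hbase
  calc B ^ ((1 : ℝ) / 2) ≤ (2 ^ 2 * mu⁻¹ * (∫ x, ‖E₀ x‖ ^ 2) * ∫ x, ‖v₀ x‖ ^ 2) ^ ((1 : ℝ) / 2) :=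
        Real.rpow_le_rpow hB0 hbase (by norm_num)
    _ = _ := by
        rw [Real.mul_rpow (by positivity) hIv, Real.mul_rpow (by positivity) hIE,
          Real.mul_rpow (by positivity) (by positivity), ← Real.sqrt_eq_rpow (2 ^ 2),
          Real.sqrt_sq (by norm_num), Real.inv_rpow hμ0.le, ← Real.rpow_neg hμ0.le, neg_div]
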